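/- Fix d ≥ 1 and a real ε with 0 < ε < 1/2. The function k ↦ v(G_d[k])_1, sending an index k ∈ {0, 1, …, 2^d − 1} to the first coordinate of the Klee-Minty vertex of the k-th Gray code string, is strictly increasing; that is, the vertices of the Klee-Minty cube sorted in increasing objective value x_1 appear precisely in Gray code order. -/

import Mathlib

/-- The `d`-bit Gray code: `grayCode d k` is the `k`-th bit string (length `d`)
of the Gray code sequence, `G₁ = (0,1)`,
`G_{d+1}[k] = 0·G_d[k]` if `k < 2^d` and `G_{d+1}[k] = 1·G_d[2^{d+1}-1-k]` otherwise. -/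
def grayCode : (d : ℕ) → ℕ → (Fin d → Bool)
  | 0, _ => fun i => i.elim0
  | d + 1, k =>
    if k < 2 ^ d then Fin.cons false (grayCode d k)
    else Fin.cons true (grayCode d (2 ^ (d + 1) - 1 - k))

/-- Helper for the Klee-Minty vertex: value of the top coordinate for a list of bits,
via the downward recursion `v_i = ε·v_{i+1}` if `b_i = 0`, `v_i = 1 - ε·v_{i+1}` if `b_i = 1`,
with `v` of the empty list equal to `0` (so a single bit gives `0` or `1`). -/
noncomputable def kmF (ε : ℝ) : List Bool → ℝ
  | [] => 0
  | x :: l => if x = true then 1 - ε * kmF ε l else ε * kmF ε l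

/-- The Klee-Minty vertex `v(b) ∈ ℝ^d` of a bit string `b ∈ {0,1}^d`:
`v(b)_{d-1} = b_{d-1}` and `v(b)_i = ε·v(b)_{i+1}` if `b_i = 0`,
`v(b)_i = 1 - ε·v(b)_{i+1}` if `b_i = 1` (0-indexed). -/
noncomputable def kmVertex (ε : ℝ) (d : ℕ) (b : Fin d → Bool) : Fin d → ℝ :=
  fun i => kmF ε ((List.ofFn b).drop i.val)

theorem kmF_mem_Icc {ε : ℝ} (hε0 : 0 ≤ ε) (hε1 : ε ≤ 1) (l : List Bool) :
    kmF ε l ∈ Set.Icc 0 1 := by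
  induction l with
  | nil => simp [kmF]
  | cons x l ih =>
    have h0 : 0 ≤ ε * kmF ε l := mul_nonneg hε0 ih.1
    have h1 : ε * kmF ε l ≤ 1 := mul_le_one₀ hε1 ih.1 ih.2
    cases x <;> simp [kmF, h0, h1]

theorem kmF_grayCode_succ (ε : ℝ) (d k : ℕ) :
    kmF ε (List.ofFn (grayCode (d + 1) k)) =
      if k < 2 ^ d then ε * kmF ε (List.ofFn (grayCode d k))
      else 1 - ε * kmF ε (List.ofFn (grayCode d (2 ^ (d + 1) - 1 - k))) := by
  by_cases h : k < 2 ^ d <;> simp [grayCode, h, kmF, List.ofFn_succ]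

theorem kmF_grayCode_strictMonoOn {ε : ℝ} (hε0 : 0 < ε) (hε1 : ε < 1 / 2) (d : ℕ) :
    StrictMonoOn (fun k => kmF ε (List.ofFn (grayCode d k))) (Set.Iio (2 ^ d)) := by
  induction d with
  | zero =>
    intro j hj k hk hjk
    simp only [pow_zero, Set.mem_Iio] at hj hk
    omega
  | succ d ih =>
    intro j hj k hk hjk
    simp only [Set.mem_Iio] at hj hk
    simp only [kmF_grayCode_succ]
    have hpow : 2 ^ (d + 1) = 2 * 2 ^ d := pow_succ' 2 d
    split_ifs with h₁ h₂ h₂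
    · exact mul_lt_mul_of_pos_left (ih h₁ h₂ hjk) hε0
    · have hle (l : List Bool) : ε * kmF ε l ≤ ε :=
        mul_le_of_le_one_right hε0.le (kmF_mem_Icc hε0.le (by linarith) l).2
      linarith [hle (List.ofFn (grayCode d j)),
        hle (List.ofFn (grayCode d (2 ^ (d + 1) - 1 - k)))]
    · omega
    · have hlt : kmF ε (List.ofFn (grayCode d (2 ^ (d + 1) - 1 - k))) <
          kmF ε (List.ofFn (grayCode d (2 ^ (d + 1) - 1 - j))) :=
        ih (Set.mem_Iio.2 (by omega)) (Set.mem_Iio.2 (by omega)) (by omega)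
      exact sub_lt_sub_left (mul_lt_mul_of_pos_left hlt hε0) 1

/-- The first coordinate of the Klee-Minty vertex of the `k`-th Gray code string
is strictly increasing in `k`: the vertices of the Klee-Minty cube sorted in
increasing objective value appear precisely in Gray code order. -/
theorem kmVertex_grayCode_strictMono (d : ℕ) (hd : 1 ≤ d) (ε : ℝ)
    (hε0 : 0 < ε) (hε1 : ε < 1 / 2) :
    StrictMono (fun k : Fin (2 ^ d) => kmVertex ε d (grayCode d k.val) ⟨0, hd⟩) := by
  intro j k hjk
  exact kmF_grayCode_strictMonoOn hε0 hε1 d j.isLt k.isLt hjk
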